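/- Let α : ℝ → ℝ be a locally Lipschitz, strictly monotone increasing function with α(0) = 0, let t₀ ∈ ℝ, and let h : ℝ → ℝ be differentiable with h'(t) ≥ -α(h(t)) for all t ≥ t₀. If h(t₀) ≥ 0, then h(t) ≥ 0 for all t ≥ t₀. -/

import Mathlib

/-- General zeroing-CBF forward invariance: if `α` is locally Lipschitz, strictly
increasing with `α 0 = 0`, `h` is differentiable with `h' t ≥ -α (h t)` for all
`t ≥ t₀`, and `h t₀ ≥ 0`, then `h t ≥ 0` for all `t ≥ t₀`. -/
theorem zcbf_forward_invariance_classK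
    (α : ℝ → ℝ) (hα_lip : LocallyLipschitz α) (hα_mono : StrictMono α)
    (hα0 : α 0 = 0) (t₀ : ℝ) (h : ℝ → ℝ)
    (hdiff : Differentiable ℝ h)
    (hineq : ∀ t, t₀ ≤ t → deriv h t ≥ -α (h t))
    (h0 : 0 ≤ h t₀) :
    ∀ t, t₀ ≤ t → 0 ≤ h t := by
  intro T hT
  by_contra! hneg
  have hcont : Continuous h := hdiff.continuous
  have hcompact : IsCompact (Set.Icc t₀ T ∩ {t | 0 ≤ h t}) :=
    isCompact_Icc.inter_right (isClosed_le continuous_const hcont)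
  obtain ⟨s, ⟨⟨hs₀, hsT⟩, hs⟩, hmax⟩ :=
    hcompact.exists_isGreatest ⟨t₀, ⟨le_rfl, hT⟩, h0⟩
  replace hs : 0 ≤ h s := hs
  have hlt : s < T := lt_of_le_of_ne hsT (by rintro rfl; exact hneg.not_ge hs)
  obtain ⟨c, ⟨hsc, hcT⟩, hc⟩ :=
    exists_deriv_eq_slope h hlt hcont.continuousOn hdiff.differentiableOn
  have hc_neg : h c < 0 := by
    by_contra! hc_nonneg
    exact hsc.not_ge (hmax ⟨⟨hs₀.trans hsc.le, hcT.le⟩, hc_nonneg⟩)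
  have hα_neg : α (h c) < 0 := hα0 ▸ hα_mono hc_neg
  have hslope : (h T - h s) / (T - s) < 0 :=
    div_neg_of_neg_of_pos (by linarith) (sub_pos.2 hlt)
  linarith [hineq c (hs₀.trans hsc.le)]
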